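/- Let λ, μ > 0, N ≥ 2, Λ_N = (N+2)/(2(N−1)), and l ≥ 1. Let L_{2l} be the linear span of the functions ∏_{i=1}^N H_{2α_i}(v_i) with Σ_i α_i = l. Let Γ_l = ∫_{S^{N−1}} ω₁^{2l} dσ(ω) (normalized uniform measure on the unit sphere), and let x_l be the smaller real root of x² − (λΛ_N + (2−s_{2l})μ)x + (1−s_{2l})μ² + λΛ_N μ − λΛ_N μ s_{2l} N Γ_l = 0. Then for every h ∈ L_{2l}, ⟨h, (μ𝓛_T + λΛ_N(I−B))h⟩ ≥ x_l ‖h‖², i.e. the smallest eigenvalue of μ𝓛_T + λΛ_N(I−B) restricted to L_{2l} is at least x_l. -/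

import Mathlib

open MeasureTheory Real
open scoped BigOperators

noncomputable section

/-- standard Gaussian density on ℝ -/
def g (v : ℝ) : ℝ := (Real.sqrt (2 * Real.pi))⁻¹ * Real.exp (-v ^ 2 / 2)

/-- product Gaussian density on ℝᴺ -/
def gam (N : ℕ) (v : Fin N → ℝ) : ℝ := ∏ i, g (v i)

/-- the Gaussian measure γ(v)dv on ℝᴺ -/
def gmeas (N : ℕ) : Measure (Fin N → ℝ) :=
  volume.withDensity (fun v => ENNReal.ofReal (gam N v))

/-- average over θ ∈ [0, 2π] -/
def avg (F : ℝ → ℝ) : ℝ := (2 * Real.pi)⁻¹ * ∫ θ in (0:ℝ)..(2 * Real.pi), F θ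

/-- v with coordinates i,j rotated by angle θ -/
def rot (N : ℕ) (v : Fin N → ℝ) (i j : Fin N) (θ : ℝ) : Fin N → ℝ :=
  Function.update (Function.update v i (v i * Real.cos θ + v j * Real.sin θ)) j
    (-(v i) * Real.sin θ + v j * Real.cos θ)

/-- the Kac collision operator Q -/
def Qop (N : ℕ) (h : (Fin N → ℝ) → ℝ) (v : Fin N → ℝ) : ℝ :=
  ((N.choose 2 : ℝ))⁻¹ * ∑ i : Fin N, ∑ j : Fin N,
    if i < j then avg (fun θ => h (rot N v i j θ)) else 0

/-- 𝓛_K = N (I - Q) -/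
def LK (N : ℕ) (h : (Fin N → ℝ) → ℝ) (v : Fin N → ℝ) : ℝ :=
  (N : ℝ) * (h v - Qop N h v)

/-- v with j-th coordinate replaced by v_j cos θ + w sin θ -/
def rotw (N : ℕ) (v : Fin N → ℝ) (j : Fin N) (θ w : ℝ) : Fin N → ℝ :=
  Function.update v j (v j * Real.cos θ + w * Real.sin θ)

/-- the thermostat operator T_j -/
def Tj (N : ℕ) (j : Fin N) (h : (Fin N → ℝ) → ℝ) (v : Fin N → ℝ) : ℝ :=
  ∫ w : ℝ, g w * avg (fun θ => h (rotw N v j θ w))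

/-- 𝓛_T = Σ_j (I - T_j) -/
def LTherm (N : ℕ) (h : (Fin N → ℝ) → ℝ) (v : Fin N → ℝ) : ℝ :=
  ∑ j : Fin N, (h v - Tj N j h v)

/-- inner product on L²(ℝᴺ, γ dv) -/
def iprod (N : ℕ) (h₁ h₂ : (Fin N → ℝ) → ℝ) : ℝ :=
  ∫ v : Fin N → ℝ, h₁ v * h₂ v * gam N v

/-- probabilist's Hermite polynomial H_α(v) = (−1)ᵅ e^{v²/2} (d/dv)ᵅ e^{−v²/2} -/
def Herm (n : ℕ) (v : ℝ) : ℝ :=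
  (-1 : ℝ) ^ n * Real.exp (v ^ 2 / 2) * iteratedDeriv n (fun x => Real.exp (-x ^ 2 / 2)) v

/-- s_n = (2π)⁻¹ ∫₀^{2π} cosⁿ θ dθ -/
def sCoef (n : ℕ) : ℝ := avg (fun θ => Real.cos θ ^ n)

/-- the master-equation thermostat operator R_j acting on densities -/
def Rop (N : ℕ) (j : Fin N) (f : (Fin N → ℝ) → ℝ) (v : Fin N → ℝ) : ℝ :=
  ∫ w : ℝ, avg (fun θ =>
    g (-(v j) * Real.sin θ + w * Real.cos θ) * f (rotw N v j θ w))

/-- relative entropy S(f|γ) -/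
def relEnt (N : ℕ) (f : (Fin N → ℝ) → ℝ) : ℝ :=
  ∫ v : Fin N → ℝ, f v * Real.log (f v / gam N v)

/-- the normalized uniform probability measure on the unit sphere S^{N−1} ⊂ ℝᴺ -/
def sphMeas (N : ℕ) : Measure (Metric.sphere (0 : EuclideanSpace ℝ (Fin N)) 1) :=
  (((volume : Measure (EuclideanSpace ℝ (Fin N))).toSphere Set.univ)⁻¹ •
    (volume : Measure (EuclideanSpace ℝ (Fin N))).toSphere)

/-- B, the orthogonal projection onto radial functions: the average of h over the
sphere of radius |v|. -/
def Bproj (N : ℕ) (h : (Fin N → ℝ) → ℝ) (v : Fin N → ℝ) : ℝ :=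
  ∫ ω : Metric.sphere (0 : EuclideanSpace ℝ (Fin N)) 1,
    h (fun i => Real.sqrt (∑ k, v k ^ 2) * (ω : EuclideanSpace ℝ (Fin N)) i)
    ∂(sphMeas N)

open Polynomial in
/-- The real probabilist's Hermite polynomial. -/
def hermiteReal (n : ℕ) : Polynomial ℝ := (hermite n).map (Int.castRingHom ℝ)

open Polynomial in
lemma herm_eq_eval (n : ℕ) (v : ℝ) : Herm n v = (hermiteReal n).eval v := by
  have h1 := hermite_eq_deriv_gaussian' n v
  rw [hermiteReal, eval_map, ← algebraMap_int_eq, ← aeval_def, h1, Herm, iteratedDeriv_eq_iterate]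
  have : (fun x : ℝ => Real.exp (-x ^ 2 / 2)) = fun y => Real.exp (-(y ^ 2 / 2)) := by
    ext; ring_nf
  rw [this]; ring

open Polynomial in
lemma hermiteReal_zero : hermiteReal 0 = 1 := by simp [hermiteReal]

open Polynomial in
lemma hermiteReal_succ (n : ℕ) :
    hermiteReal (n + 1) = X * hermiteReal n - derivative (hermiteReal n) := by
  simp [hermiteReal, hermite_succ, derivative_map]

open Polynomial in
lemma natDegree_hermiteReal (n : ℕ) : (hermiteReal n).natDegree = n := by
  rw [hermiteReal, (hermite_monic n).natDegree_map, natDegree_hermite]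

open Polynomial in
lemma coeff_hermiteReal_self (n : ℕ) : (hermiteReal n).coeff n = 1 := by
  simp [hermiteReal]

open Polynomial in
lemma coeff_hermiteReal_of_odd_add {n k : ℕ} (h : Odd (n + k)) : (hermiteReal n).coeff k = 0 := by
  simp [hermiteReal, coeff_hermite_of_odd_add h]

lemma sum_range_odd_vanish (f : ℕ → ℝ) (hf : ∀ k, Odd k → f k = 0) (a : ℕ) :
    ∑ k ∈ Finset.range (2 * a + 1), f k = ∑ k ∈ Finset.range (a + 1), f (2 * k) := by
  induction a with
  | zero => simp
  | succ a ih =>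
    rw [Finset.sum_range_succ _ (a + 1), ← ih, show 2 * (a + 1) + 1 = 2 * a + 1 + 1 + 1 by ring,
      Finset.sum_range_succ, Finset.sum_range_succ, hf (2 * a + 1) ⟨a, rfl⟩]
    simp [mul_add]

open Polynomial in
lemma herm_even_expand (a : ℕ) (x : ℝ) :
    Herm (2 * a) x = ∑ k ∈ Finset.range (a + 1), (hermiteReal (2 * a)).coeff (2 * k) * x ^ (2 * k) := by
  rw [herm_eq_eval, eval_eq_sum_range, natDegree_hermiteReal, sum_range_odd_vanish]
  intro k hk
  rw [coeff_hermiteReal_of_odd_add ((even_two_mul a).add_odd hk), zero_mul]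

lemma g_eq (x : ℝ) : g x = (Real.sqrt (2 * Real.pi))⁻¹ * Real.exp (-(1 / 2) * x ^ 2) := by
  unfold g; ring_nf

lemma integral_g : ∫ w, g w = 1 := by
  simp_rw [g_eq, integral_const_mul, integral_gaussian]
  rw [show Real.pi / (1 / 2) = 2 * Real.pi by ring]
  exact inv_mul_cancel₀ (by positivity)

lemma integrable_g_mul_pow (n : ℕ) : Integrable (fun w => g w * w ^ n) := by
  have := (integrable_rpow_mul_exp_neg_mul_sq (b := 1 / 2) (by norm_num) (s := n)
    (by linarith [n.cast_nonneg (α := ℝ)])).const_mul (Real.sqrt (2 * Real.pi))⁻¹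
  refine this.congr (.of_forall fun x => ?_)
  simp only [g_eq, Real.rpow_natCast]; ring

open Polynomial in
lemma integrable_g_mul_eval (P : ℝ[X]) : Integrable (fun w => g w * P.eval w) := by
  simp_rw [eval_eq_sum_range, Finset.mul_sum]
  refine integrable_finsetSum _ fun k _ => ?_
  exact ((integrable_g_mul_pow k).const_mul (P.coeff k)).congr (.of_forall fun w => by ring)

open Polynomial in
/-- The expectation of a polynomial in a standard Gaussian variable. -/
def gaussE (P : ℝ[X]) : ℝ := ∫ w, g w * P.eval w

open Polynomial in
lemma gaussE_add (P Q : ℝ[X]) : gaussE (P + Q) = gaussE P + gaussE Q := by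
  simp_rw [gaussE, eval_add, mul_add]
  exact integral_add (integrable_g_mul_eval P) (integrable_g_mul_eval Q)

open Polynomial in
lemma gaussE_sub (P Q : ℝ[X]) : gaussE (P - Q) = gaussE P - gaussE Q := by
  simp_rw [gaussE, eval_sub, mul_sub]
  exact integral_sub (integrable_g_mul_eval P) (integrable_g_mul_eval Q)

open Polynomial in
lemma gaussE_C_mul (a : ℝ) (P : ℝ[X]) : gaussE (C a * P) = a * gaussE P := by
  simp_rw [gaussE, eval_mul, eval_C, ← integral_const_mul]
  congr 1; ext; ring

open Polynomial in
lemma gaussE_one : gaussE 1 = 1 := by simp [gaussE, integral_g]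

lemma hasDerivAt_g (x : ℝ) : HasDerivAt g (-(x * g x)) x := by
  unfold g
  have h1 : HasDerivAt (fun y : ℝ => -y ^ 2 / 2) (-x) x := by
    exact ((hasDerivAt_pow 2 x).neg.div_const 2).congr_deriv (by push_cast; ring)
  exact (h1.exp.const_mul (Real.sqrt (2 * Real.pi))⁻¹).congr_deriv (by ring)

open Polynomial in
/-- Gaussian integration by parts for polynomials. -/
lemma gaussE_X_mul (P : ℝ[X]) : gaussE (X * P) = gaussE (derivative P) := by
  rw [← sub_eq_zero, ← gaussE_sub]
  have := integral_eq_zero_of_hasDerivAt_of_integrable (f := fun w => -(g w * P.eval w))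
    (f' := fun w => g w * (X * P - derivative P).eval w) (fun x => ?_)
    (integrable_g_mul_eval _) (integrable_g_mul_eval P).neg
  · exact this
  · refine ((hasDerivAt_g x).mul (P.hasDerivAt x)).neg.congr_deriv ?_
    rw [eval_sub, eval_mul, eval_X]
    ring

open Polynomial in
lemma gaussE_mul_hermite (P : ℝ[X]) (n : ℕ) :
    gaussE (P * hermiteReal n) = gaussE (derivative^[n] P) := by
  induction n generalizing P with
  | zero => simp [hermiteReal_zero]
  | succ n ih =>
    rw [hermiteReal_succ, Function.iterate_succ_apply, ← ih, mul_sub, gaussE_sub,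
      mul_left_comm, gaussE_X_mul, derivative_mul, gaussE_add]
    ring

open Polynomial in
lemma gaussE_mul_hermite_of_lt {P : ℝ[X]} {n : ℕ} (h : P.natDegree < n) :
    gaussE (P * hermiteReal n) = 0 := by
  rw [gaussE_mul_hermite, iterate_derivative_eq_zero h]
  simp [gaussE]

open Polynomial in
lemma gaussE_mul_hermite_of_natDegree {P : ℝ[X]} {n : ℕ} (h : P.natDegree = n)
    (hc : P.coeff n = 1) : gaussE (P * hermiteReal n) = n.factorial := by
  have h0 : (derivative^[n] P).natDegree ≤ 0 := by
    refine (natDegree_iterate_derivative P n).trans (by simp [h])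
  rw [gaussE_mul_hermite, eq_C_of_natDegree_le_zero h0, coeff_iterate_derivative]
  simp [hc, gaussE, integral_mul_const, integral_g, Nat.descFactorial_self]

lemma gaussE_hermite_mul_hermite (m n : ℕ) :
    gaussE (hermiteReal m * hermiteReal n) = if m = n then (n.factorial : ℝ) else 0 := by
  rcases lt_trichotomy m n with h | h | h
  · rw [gaussE_mul_hermite_of_lt (by rwa [natDegree_hermiteReal]), if_neg h.ne]
  · subst h
    rw [if_pos rfl, gaussE_mul_hermite_of_natDegree (natDegree_hermiteReal _)
      (coeff_hermiteReal_self _)]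
  · rw [mul_comm, gaussE_mul_hermite_of_lt (by rwa [natDegree_hermiteReal]), if_neg h.ne']

open Polynomial in
lemma gaussE_X_pow_two_mul (k : ℕ) :
    gaussE (X ^ (2 * k)) = (2 * k).factorial / (2 ^ k * k.factorial) := by
  induction k with
  | zero => simp [gaussE_one]
  | succ k ih =>
    rw [show 2 * (k + 1) = 2 * k + 1 + 1 by ring, pow_succ', gaussE_X_mul, derivative_X_pow,
      gaussE_C_mul, Nat.add_sub_cancel, ih, Nat.factorial_succ, Nat.factorial_succ,
      Nat.factorial_succ k]
    push_cast
    field_simp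
    ring

open Polynomial in
lemma derivative_hermiteReal (n : ℕ) :
    derivative (hermiteReal (n + 1)) = C ((n : ℝ) + 1) * hermiteReal n := by
  induction n with
  | zero => simp [hermiteReal_succ, hermiteReal_zero]
  | succ n ih =>
    rw [hermiteReal_succ (n + 1), derivative_sub, derivative_mul, derivative_X, ih,
      derivative_C_mul, hermiteReal_succ n]
    simp only [Nat.cast_add, Nat.cast_one, C_add, C_1]
    ring

open Polynomial in
/-- Mehler's formula for Hermite polynomials. -/
lemma gaussE_hermite_comp (n : ℕ) {c s : ℝ} (hcs : c ^ 2 + s ^ 2 = 1) (v : ℝ) :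
    gaussE ((hermiteReal n).comp (C (v * c) + C s * X)) = c ^ n * (hermiteReal n).eval v := by
  induction n using Nat.strong_induction_on with
  | _ n ih =>
    match n with
    | 0 => simp [hermiteReal_zero, gaussE_one]
    | 1 =>
      have : gaussE (C s * X) = 0 := by
        rw [← mul_one (C s * X), mul_assoc, gaussE_C_mul, gaussE_X_mul]; simp [gaussE]
      have h2 : gaussE (C (v * c)) = v * c := by
        rw [← mul_one (C (v * c)), gaussE_C_mul, gaussE_one, mul_one]
      simp only [hermiteReal_succ 0, hermiteReal_zero, derivative_one, mul_one, sub_zero, X_comp,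
        gaussE_add, this, h2]
      simp; ring
    | n + 2 =>
      have i1 := ih (n + 1) (by omega)
      have i0 := ih n (by omega)
      have key : gaussE (X * (hermiteReal (n + 1)).comp (C (v * c) + C s * X))
          = s * ((n + 1) * gaussE ((hermiteReal n).comp (C (v * c) + C s * X))) := by
        rw [gaussE_X_mul, derivative_comp, derivative_hermiteReal, mul_comp, C_comp,
          ← gaussE_C_mul, ← gaussE_C_mul]
        congr 1
        simp
      have e : (hermiteReal (n + 2)).comp (C (v * c) + C s * X)
          = C (v * c) * (hermiteReal (n + 1)).comp (C (v * c) + C s * X)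
            + C s * (X * (hermiteReal (n + 1)).comp (C (v * c) + C s * X))
            - C ((n : ℝ) + 1) * (hermiteReal n).comp (C (v * c) + C s * X) := by
        rw [hermiteReal_succ (n + 1), derivative_hermiteReal, sub_comp, mul_comp, mul_comp, X_comp,
          C_comp]
        ring
      rw [e, gaussE_sub, gaussE_add, gaussE_C_mul, gaussE_C_mul, gaussE_C_mul, key, i1, i0,
        hermiteReal_succ (n + 1), derivative_hermiteReal]
      simp only [eval_sub, eval_mul, eval_X, eval_C]
      have : s ^ 2 = 1 - c ^ 2 := by linarith
      linear_combination ((n : ℝ) + 1) * c ^ n * (hermiteReal n).eval v * this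

lemma avg_sum {ι : Type*} (S : Finset ι) (f : ι → ℝ → ℝ) (hf : ∀ i ∈ S, Continuous (f i)) :
    avg (fun θ => ∑ i ∈ S, f i θ) = ∑ i ∈ S, avg (f i) := by
  simp only [avg]
  rw [intervalIntegral.integral_finsetSum fun i hi => (hf i hi).intervalIntegrable _ _,
    Finset.mul_sum]

lemma avg_const_mul (a : ℝ) (f : ℝ → ℝ) : avg (fun θ => a * f θ) = a * avg f := by
  simp only [avg, intervalIntegral.integral_const_mul]; ring

lemma avg_mono {f k : ℝ → ℝ} (hf : Continuous f) (hk : Continuous k) (h : ∀ θ, f θ ≤ k θ) :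
    avg f ≤ avg k := by
  unfold avg
  have := Real.two_pi_pos
  refine mul_le_mul_of_nonneg_left ?_ (by positivity)
  exact intervalIntegral.integral_mono_on this.le (hf.intervalIntegrable _ _)
    (hk.intervalIntegrable _ _) fun θ _ => h θ

lemma avg_const (a : ℝ) : avg (fun _ => a) = a := by
  have := Real.pi_pos
  simp only [avg, intervalIntegral.integral_const, smul_eq_mul, sub_zero]
  field_simp

lemma sCoef_zero : sCoef 0 = 1 := by simp [sCoef, avg_const]

lemma sCoef_two : sCoef 2 = 1 / 2 := by
  have := Real.pi_pos
  simp only [sCoef, avg, integral_cos_sq]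
  simp
  field_simp

lemma sCoef_two_mul_le (a : ℕ) (ha : a ≠ 0) : sCoef (2 * a) ≤ 1 / 2 := by
  rw [← sCoef_two, sCoef, sCoef]
  refine avg_mono (by fun_prop) (by fun_prop) fun θ => ?_
  rw [pow_mul]
  exact pow_le_of_le_one (sq_nonneg _) (Real.cos_sq_le_one θ) ha

open Polynomial in
lemma eval_comp_add_mul (P : ℝ[X]) (a s w : ℝ) :
    (P.comp (C a + C s * X)).eval w
      = ∑ k ∈ Finset.range (P.natDegree + 1), (hasseDeriv k P).eval a * s ^ k * w ^ k := by
  rw [eval_comp, eval_add, eval_C, eval_mul, eval_C, eval_X, add_comm, ← taylor_eval,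
    eval_eq_sum_range, natDegree_taylor]
  simp only [taylor_coeff, mul_pow, mul_assoc]

open Polynomial in
/-- Averaging over the angle commutes with Gaussian averaging. -/
lemma integral_g_mul_avg_eval (P : ℝ[X]) (v : ℝ) :
    ∫ w, g w * avg (fun θ => P.eval (v * Real.cos θ + w * Real.sin θ))
      = avg (fun θ => gaussE (P.comp (C (v * Real.cos θ) + C (Real.sin θ) * X))) := by
  have h1 : ∀ w, g w * avg (fun θ => P.eval (v * Real.cos θ + w * Real.sin θ))
      = ∑ k ∈ Finset.range (P.natDegree + 1),
        avg (fun θ => (hasseDeriv k P).eval (v * Real.cos θ) * Real.sin θ ^ k) * (g w * w ^ k) := by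
    intro w
    have : (fun θ => P.eval (v * Real.cos θ + w * Real.sin θ)) = fun θ =>
        ∑ k ∈ Finset.range (P.natDegree + 1),
          w ^ k * ((hasseDeriv k P).eval (v * Real.cos θ) * Real.sin θ ^ k) := by
      ext θ
      have := eval_comp_add_mul P (v * Real.cos θ) (Real.sin θ) w
      rw [eval_comp, eval_add, eval_C, eval_mul, eval_C, eval_X] at this
      rw [mul_comm w, this]
      exact Finset.sum_congr rfl fun k _ => by ring
    rw [this, avg_sum _ _ fun k _ => by fun_prop, Finset.mul_sum]
    exact Finset.sum_congr rfl fun k _ => by rw [avg_const_mul]; ring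
  have h2 : ∀ θ, gaussE (P.comp (C (v * Real.cos θ) + C (Real.sin θ) * X))
      = ∑ k ∈ Finset.range (P.natDegree + 1), (∫ w, g w * w ^ k) *
        ((hasseDeriv k P).eval (v * Real.cos θ) * Real.sin θ ^ k) := by
    intro θ
    simp_rw [gaussE, eval_comp_add_mul, Finset.mul_sum]
    rw [integral_finsetSum]
    · refine Finset.sum_congr rfl fun k _ => ?_
      rw [← integral_mul_const]
      exact integral_congr_ae (.of_forall fun w => by ring)
    · intro k _
      exact ((integrable_g_mul_pow k).mul_const _).congr (.of_forall fun w => by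
        show g w * w ^ k * ((hasseDeriv k P).eval (v * Real.cos θ) * Real.sin θ ^ k) = _
        ring)
  simp_rw [h1, h2]
  rw [avg_sum _ _ fun k _ => by fun_prop,
    integral_finsetSum _ fun k _ => (integrable_g_mul_pow k).const_mul _]
  exact Finset.sum_congr rfl fun k _ => by rw [avg_const_mul, integral_const_mul]; ring

/-- The even product Hermite function `∏ᵢ H_{2βᵢ}(vᵢ)`. -/
def hermProd (N : ℕ) (β : Fin N → ℕ) (v : Fin N → ℝ) : ℝ := ∏ i, Herm (2 * β i) (v i)

lemma gaussE_sum {ι : Type*} (S : Finset ι) (f : ι → Polynomial ℝ) :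
    gaussE (∑ i ∈ S, f i) = ∑ i ∈ S, gaussE (f i) := by
  classical
  induction S using Finset.induction_on with
  | empty => simp [gaussE]
  | insert a s ha ih => rw [Finset.sum_insert ha, Finset.sum_insert ha, gaussE_add, ih]

open Polynomial in
lemma Tj_sum_hermProd (N : ℕ) (S : Finset (Fin N → ℕ)) (c : (Fin N → ℕ) → ℝ) (j : Fin N)
    (v : Fin N → ℝ) :
    Tj N j (fun v => ∑ β ∈ S, c β * hermProd N β v) v
      = ∑ β ∈ S, c β * sCoef (2 * β j) * hermProd N β v := by
  set d : (Fin N → ℕ) → ℝ := fun β => c β * ∏ i ∈ Finset.univ.erase j, Herm (2 * β i) (v i)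
  set P : ℝ[X] := ∑ β ∈ S, C (d β) * hermiteReal (2 * β j)
  have hd : ∀ β, c β * hermProd N β v = d β * (hermiteReal (2 * β j)).eval (v j) := by
    intro β
    rw [hermProd, ← Finset.mul_prod_erase _ _ (Finset.mem_univ j), herm_eq_eval]
    ring
  have hP : ∀ θ w, ∑ β ∈ S, c β * hermProd N β (rotw N v j θ w)
      = P.eval (v j * Real.cos θ + w * Real.sin θ) := by
    intro θ w
    rw [eval_finsetSum]
    refine Finset.sum_congr rfl fun β _ => ?_
    rw [hermProd, ← Finset.mul_prod_erase _ _ (Finset.mem_univ j), eval_mul, eval_C,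
      ← herm_eq_eval, rotw, Function.update_self]
    have : ∏ x ∈ Finset.univ.erase j, Herm (2 * β x)
        (Function.update v j (v j * Real.cos θ + w * Real.sin θ) x)
        = ∏ i ∈ Finset.univ.erase j, Herm (2 * β i) (v i) :=
      Finset.prod_congr rfl fun i hi => by
        rw [Function.update_of_ne (Finset.ne_of_mem_erase hi)]
    rw [this]; simp only [d]; ring
  simp only [Tj, hP]
  rw [integral_g_mul_avg_eval]
  have hE : ∀ θ, gaussE (P.comp (C (v j * Real.cos θ) + C (Real.sin θ) * X))
      = ∑ β ∈ S, (d β * (hermiteReal (2 * β j)).eval (v j)) * Real.cos θ ^ (2 * β j) := by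
    intro θ
    simp only [P, sum_comp, mul_comp, C_comp, gaussE_sum, gaussE_C_mul,
      gaussE_hermite_comp _ (Real.cos_sq_add_sin_sq θ)]
    exact Finset.sum_congr rfl fun k _ => by ring
  simp_rw [hE]
  rw [avg_sum _ _ fun β _ => by fun_prop]
  refine Finset.sum_congr rfl fun β _ => ?_
  rw [avg_const_mul, ← hd, sCoef]; ring

/-- The eigenvalue of `𝓛_T` on `∏ᵢ H_{2βᵢ}(vᵢ)`. -/
def thermEig {N : ℕ} (β : Fin N → ℕ) : ℝ := ∑ j, (1 - sCoef (2 * β j))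

lemma LTherm_sum_hermProd (N : ℕ) (S : Finset (Fin N → ℕ)) (c : (Fin N → ℕ) → ℝ)
    (v : Fin N → ℝ) :
    LTherm N (fun v => ∑ β ∈ S, c β * hermProd N β v) v
      = ∑ β ∈ S, c β * thermEig β * hermProd N β v := by
  simp only [LTherm, Tj_sum_hermProd, ← Finset.sum_sub_distrib, thermEig]
  rw [Finset.sum_comm]
  refine Finset.sum_congr rfl fun β _ => ?_
  rw [Finset.mul_sum, Finset.sum_mul]
  exact Finset.sum_congr rfl fun j _ => by ring

lemma thermEig_single {N : ℕ} (j : Fin N) (l : ℕ) :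
    thermEig (Pi.single j l) = 1 - sCoef (2 * l) := by
  rw [thermEig, Finset.sum_eq_single j]
  · simp
  · intro i _ hi
    simp [Pi.single_eq_of_ne hi, sCoef_zero]
  · simp

lemma one_le_thermEig {N : ℕ} {β : Fin N → ℕ} {l : ℕ} (hN : 0 < N) (hsum : ∑ i, β i = l)
    (hβ : ∀ j, β ≠ Pi.single j l) : 1 ≤ thermEig β := by
  obtain ⟨i, j, hij, hi, hj⟩ : ∃ i j, i ≠ j ∧ β i ≠ 0 ∧ β j ≠ 0 := by
    by_contra! hcon
    have key : ∀ i, (∀ j, i ≠ j → β j = 0) → False := by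
      intro i h
      refine hβ i (funext fun j => ?_)
      have : β i = l := by
        rw [← hsum]
        exact (Finset.sum_eq_single i (fun j _ hj => h j hj.symm) (by simp)).symm
      by_cases hji : j = i
      · subst hji; simp [this]
      · rw [h j (Ne.symm hji), Pi.single_eq_of_ne hji]
    by_cases h0 : ∃ i, β i ≠ 0
    · obtain ⟨i, hi⟩ := h0
      exact key i fun j hj => hcon i j hj hi
    · push Not at h0
      exact key ⟨0, hN⟩ fun j _ => h0 j
  have hnn : ∀ k, 0 ≤ 1 - sCoef (2 * β k) := by
    intro k
    by_cases hk : β k = 0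
    · simp [hk, sCoef_zero]
    · linarith [sCoef_two_mul_le _ hk]
  have := Finset.sum_le_sum_of_subset_of_nonneg (Finset.subset_univ {i, j})
    (f := fun k => 1 - sCoef (2 * β k)) fun k _ _ => hnn k
  rw [Finset.sum_pair hij] at this
  rw [thermEig]
  linarith [sCoef_two_mul_le _ hi, sCoef_two_mul_le _ hj]

open Polynomial in
lemma prod_eval_mul_gam {N : ℕ} (P : Fin N → ℝ[X]) (v : Fin N → ℝ) :
    (∏ i, (P i).eval (v i)) * gam N v = ∏ i, g (v i) * (P i).eval (v i) := by
  rw [gam, ← Finset.prod_mul_distrib]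
  exact Finset.prod_congr rfl fun i _ => mul_comm _ _

open Polynomial in
lemma integrable_prod_eval_mul_gam {N : ℕ} (P : Fin N → ℝ[X]) :
    Integrable (fun v => (∏ i, (P i).eval (v i)) * gam N v) := by
  simp_rw [prod_eval_mul_gam]
  exact Integrable.fintype_prod (f := fun i w => g w * (P i).eval w)
    fun i => integrable_g_mul_eval (P i)

open Polynomial in
lemma integral_prod_eval_mul_gam {N : ℕ} (P : Fin N → ℝ[X]) :
    ∫ v, (∏ i, (P i).eval (v i)) * gam N v = ∏ i, gaussE (P i) := by
  simp_rw [prod_eval_mul_gam]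
  exact integral_fintype_prod_volume_eq_prod fun i w => g w * (P i).eval w

lemma sum_sq_pow {N : ℕ} (v : Fin N → ℝ) (n : ℕ) :
    (∑ k, v k ^ 2) ^ n = ∑ γ ∈ Finset.Nat.antidiagonalTuple N n,
      (Nat.multinomial Finset.univ γ : ℝ) * ∏ i, v i ^ (2 * γ i) := by
  rw [Finset.sum_pow_eq_sum_piAntidiag, Finset.piAntidiag_univ_fin_eq_antidiagonalTuple]
  simp_rw [pow_mul]

lemma hermProd_eq_eval {N : ℕ} (β : Fin N → ℕ) (v : Fin N → ℝ) :
    hermProd N β v = ∏ i, (hermiteReal (2 * β i)).eval (v i) := by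
  simp [hermProd, herm_eq_eval]

lemma hermProd_mul_hermProd_eq {N : ℕ} (β γ : Fin N → ℕ) (v : Fin N → ℝ) :
    hermProd N β v * hermProd N γ v
      = ∏ i, (hermiteReal (2 * β i) * hermiteReal (2 * γ i)).eval (v i) := by
  simp only [hermProd_eq_eval, Polynomial.eval_mul, Finset.prod_mul_distrib]

lemma integrable_hermProd_mul_hermProd {N : ℕ} (β γ : Fin N → ℕ) :
    Integrable (fun v => hermProd N β v * hermProd N γ v * gam N v) := by
  simp_rw [hermProd_mul_hermProd_eq]
  exact integrable_prod_eval_mul_gam _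

lemma integral_hermProd_mul_hermProd {N : ℕ} (β γ : Fin N → ℕ) :
    ∫ v, hermProd N β v * hermProd N γ v * gam N v
      = if β = γ then ∏ i, ((2 * β i).factorial : ℝ) else 0 := by
  simp_rw [hermProd_mul_hermProd_eq]
  rw [integral_prod_eval_mul_gam (fun i => hermiteReal (2 * β i) * hermiteReal (2 * γ i))]
  simp_rw [gaussE_hermite_mul_hermite]
  split_ifs with h
  · subst h; simp
  · obtain ⟨i, hi⟩ := Function.ne_iff.mp h
    exact Finset.prod_eq_zero (Finset.mem_univ i) (if_neg (by omega))

lemma hermProd_mul_sum_sq_pow {N : ℕ} (β : Fin N → ℕ) (n : ℕ) (v : Fin N → ℝ) :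
    hermProd N β v * (∑ k, v k ^ 2) ^ n * gam N v
      = ∑ γ ∈ Finset.Nat.antidiagonalTuple N n, (Nat.multinomial Finset.univ γ : ℝ) *
        ((∏ i, (Polynomial.X ^ (2 * γ i) * hermiteReal (2 * β i)).eval (v i)) * gam N v) := by
  rw [sum_sq_pow, Finset.mul_sum, Finset.sum_mul]
  refine Finset.sum_congr rfl fun γ _ => ?_
  simp only [hermProd_eq_eval, Polynomial.eval_mul, Finset.prod_mul_distrib, Polynomial.eval_pow,
    Polynomial.eval_X]
  ring

lemma integrable_hermProd_mul_sum_sq_pow {N : ℕ} (β : Fin N → ℕ) (n : ℕ) :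
    Integrable (fun v => hermProd N β v * (∑ k, v k ^ 2) ^ n * gam N v) := by
  simp_rw [hermProd_mul_sum_sq_pow]
  exact integrable_finsetSum _ fun γ _ => (integrable_prod_eval_mul_gam _).const_mul _

lemma prod_gaussE_X_pow_mul_hermite {N n : ℕ} {β γ : Fin N → ℕ} (hγ : ∑ i, γ i = n)
    (hβ : n ≤ ∑ i, β i) :
    ∏ i, gaussE (Polynomial.X ^ (2 * γ i) * hermiteReal (2 * β i))
      = if γ = β then ∏ i, ((2 * β i).factorial : ℝ) else 0 := by
  split_ifs with h
  · subst h
    exact Finset.prod_congr rfl fun i _ =>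
      gaussE_mul_hermite_of_natDegree (by simp) (by simp)
  · obtain ⟨i, hi⟩ : ∃ i, γ i < β i := by
      by_contra! hcon
      refine h (funext fun i => ?_)
      have := (Finset.sum_eq_sum_iff_of_le fun i _ => hcon i).mp
        (le_antisymm (Finset.sum_le_sum fun i _ => hcon i) (hγ ▸ hβ))
      exact (this i (Finset.mem_univ i)).symm
    exact Finset.prod_eq_zero (Finset.mem_univ i)
      (gaussE_mul_hermite_of_lt (by rw [Polynomial.natDegree_X_pow]; omega))

lemma integral_hermProd_mul_sum_sq_pow {N n : ℕ} (β : Fin N → ℕ) (hβ : n ≤ ∑ i, β i) :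
    ∫ v, hermProd N β v * (∑ k, v k ^ 2) ^ n * gam N v
      = if ∑ i, β i = n then
          (Nat.multinomial Finset.univ β : ℝ) * ∏ i, ((2 * β i).factorial : ℝ)
        else 0 := by
  simp_rw [hermProd_mul_sum_sq_pow]
  rw [integral_finsetSum _ fun γ _ => (integrable_prod_eval_mul_gam _).const_mul _]
  simp_rw [integral_const_mul]
  have : ∀ γ ∈ Finset.Nat.antidiagonalTuple N n, (Nat.multinomial Finset.univ γ : ℝ) *
      ∫ v, (∏ i, (Polynomial.X ^ (2 * γ i) * hermiteReal (2 * β i)).eval (v i)) * gam N v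
      = if γ = β then (Nat.multinomial Finset.univ β : ℝ) * ∏ i, ((2 * β i).factorial : ℝ)
        else 0 := by
    intro γ hγ
    rw [integral_prod_eval_mul_gam (fun i => Polynomial.X ^ (2 * γ i) * hermiteReal (2 * β i)),
      prod_gaussE_X_pow_mul_hermite (Finset.Nat.mem_antidiagonalTuple.mp hγ) hβ]
    split_ifs with h
    · rw [h]
    · rw [mul_zero]
  rw [Finset.sum_congr rfl this, Finset.sum_ite_eq']
  simp only [Finset.Nat.mem_antidiagonalTuple]

/-- The even moments of the uniform measure on the unit sphere. -/
def sphMoment (N : ℕ) (γ : Fin N → ℕ) : ℝ :=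
  ∫ ω : Metric.sphere (0 : EuclideanSpace ℝ (Fin N)) 1,
    ∏ i, (ω : EuclideanSpace ℝ (Fin N)) i ^ (2 * γ i) ∂(sphMeas N)

lemma isProbabilityMeasure_sphMeas {N : ℕ} (hN : 0 < N) : IsProbabilityMeasure (sphMeas N) := by
  have : NeZero N := ⟨hN.ne'⟩
  constructor
  rw [sphMeas, Measure.smul_apply, smul_eq_mul]
  exact ENNReal.inv_mul_cancel
    (Measure.measure_univ_ne_zero.mpr (Measure.toSphere_ne_zero _)) (measure_ne_top _ _)

lemma integrable_sphMeas {N : ℕ} (hN : 0 < N)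
    {f : Metric.sphere (0 : EuclideanSpace ℝ (Fin N)) 1 → ℝ} (hf : Continuous f) :
    Integrable f (sphMeas N) := by
  have := isProbabilityMeasure_sphMeas hN
  exact hf.integrable_of_hasCompactSupport (HasCompactSupport.of_compactSpace f)

lemma continuous_sphere_monomial {N : ℕ} (γ : Fin N → ℕ) :
    Continuous fun ω : Metric.sphere (0 : EuclideanSpace ℝ (Fin N)) 1 =>
      ∏ i, (ω : EuclideanSpace ℝ (Fin N)) i ^ (2 * γ i) := by
  fun_prop

lemma sum_multinomial_mul_sphMoment {N : ℕ} (hN : 0 < N) (l : ℕ) :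
    ∑ γ ∈ Finset.Nat.antidiagonalTuple N l,
      (Nat.multinomial Finset.univ γ : ℝ) * sphMoment N γ = 1 := by
  have := isProbabilityMeasure_sphMeas hN
  simp_rw [sphMoment, ← integral_const_mul]
  rw [← integral_finsetSum _ fun γ _ =>
    (integrable_sphMeas hN (continuous_sphere_monomial γ)).const_mul _]
  rw [integral_congr_ae (g := fun _ => (1 : ℝ)) (.of_forall fun ω => ?_)]
  · simp
  · show ∑ γ ∈ Finset.Nat.antidiagonalTuple N l, (Nat.multinomial Finset.univ γ : ℝ) *
      ∏ i, (ω : EuclideanSpace ℝ (Fin N)) i ^ (2 * γ i) = 1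
    have hω : ∑ k, (ω : EuclideanSpace ℝ (Fin N)) k ^ 2 = 1 := by
      have h := EuclideanSpace.real_norm_sq_eq (ω : EuclideanSpace ℝ (Fin N))
      rw [norm_eq_of_mem_sphere ω] at h
      rw [← h]; norm_num
    rw [← sum_sq_pow, hω, one_pow]

/-- Gaussian moments and spherical moments of the same degree are proportional. -/
lemma exists_prod_gaussE_eq_mul_sphMoment {N : ℕ} (hN : 0 < N) (l : ℕ) :
    ∃ R : ℝ, ∀ γ : Fin N → ℕ, ∑ i, γ i = l →
      ∏ i, gaussE (Polynomial.X ^ (2 * γ i)) = R * sphMoment N γ := by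
  have : NeZero N := ⟨hN.ne'⟩
  set E := EuclideanSpace ℝ (Fin N)
  set μ : Measure E := volume
  set K : Set.Ioi (0 : ℝ) → ℝ := fun r =>
    r.1 ^ (2 * l) * ((Real.sqrt (2 * Real.pi))⁻¹ ^ N * Real.exp (-r.1 ^ 2 / 2))
  refine ⟨(μ.toSphere Set.univ).toReal *
    ∫ r, K r ∂(Measure.volumeIoiPow (Module.finrank ℝ E - 1)), fun γ hγ => ?_⟩
  have hgam : ∀ x : E, gam N x = (Real.sqrt (2 * Real.pi))⁻¹ ^ N * Real.exp (-‖x‖ ^ 2 / 2) := by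
    intro x
    simp only [gam, g, Finset.prod_mul_distrib, Finset.prod_const, Finset.card_univ,
      Fintype.card_fin, ← Real.exp_sum]
    rw [← Finset.sum_div, Finset.sum_neg_distrib, EuclideanSpace.real_norm_sq_eq]
  let G : Metric.sphere (0 : E) 1 → ℝ := fun ω => ∏ i, (ω : E) i ^ (2 * γ i)
  have hpt : ∀ x : ({0}ᶜ : Set E), (∏ i, x.1 i ^ (2 * γ i)) * gam N x.1
      = G (homeomorphUnitSphereProd E x).1 * K (homeomorphUnitSphereProd E x).2 := by
    intro x
    have hx : ‖x.1‖ ≠ 0 := norm_ne_zero_iff.mpr x.2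
    have h1 : ∏ i, x.1 i ^ (2 * γ i)
        = ‖x.1‖ ^ (2 * l) * ∏ i, (‖x.1‖⁻¹ * x.1 i) ^ (2 * γ i) := by
      rw [← hγ, Finset.mul_sum, ← Finset.prod_pow_eq_pow_sum, ← Finset.prod_mul_distrib]
      refine Finset.prod_congr rfl fun i _ => ?_
      rw [← mul_pow, mul_inv_cancel_left₀ hx]
    have hG : G (homeomorphUnitSphereProd E x).1 = ∏ i, (‖x.1‖⁻¹ * x.1 i) ^ (2 * γ i) := by
      simp only [G, homeomorphUnitSphereProd_apply_fst_coe]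
      rfl
    have hK : K (homeomorphUnitSphereProd E x).2 = ‖x.1‖ ^ (2 * l) *
        ((Real.sqrt (2 * Real.pi))⁻¹ ^ N * Real.exp (-‖x.1‖ ^ 2 / 2)) := by
      simp only [K, homeomorphUnitSphereProd_apply_snd_coe]
    rw [h1, hgam, hG, hK]
    ring
  calc ∏ i, gaussE (Polynomial.X ^ (2 * γ i))
      = ∫ v : Fin N → ℝ, (∏ i, v i ^ (2 * γ i)) * gam N v := by
        rw [← integral_prod_eval_mul_gam]; simp
    _ = ∫ x : E, (∏ i, x i ^ (2 * γ i)) * gam N x :=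
        ((PiLp.volume_preserving_ofLp (Fin N)).integral_comp
          (MeasurableEquiv.toLp 2 (Fin N → ℝ)).symm.measurableEmbedding
          (fun v => (∏ i, v i ^ (2 * γ i)) * gam N v)).symm
    _ = ∫ x : ({0}ᶜ : Set E), (∏ i, x.1 i ^ (2 * γ i)) * gam N x.1 ∂(μ.comap (↑)) := by
        rw [integral_subtype_comap (measurableSet_singleton _).compl
          fun x : E => (∏ i, x i ^ (2 * γ i)) * gam N x, restrict_compl_singleton]
    _ = ∫ p, G p.1 * K p.2 ∂μ.toSphere.prod (.volumeIoiPow (Module.finrank ℝ E - 1)) := by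
        simp_rw [hpt]
        exact μ.measurePreserving_homeomorphUnitSphereProd.integral_comp
          (Homeomorph.measurableEmbedding _)
          (fun p : Metric.sphere (0 : E) 1 × Set.Ioi (0 : ℝ) => G p.1 * K p.2)
    _ = (∫ ω, G ω ∂μ.toSphere) * ∫ r, K r ∂(Measure.volumeIoiPow (Module.finrank ℝ E - 1)) :=
        integral_prod_mul _ _
    _ = _ := by
        have h0 : (μ.toSphere Set.univ).toReal ≠ 0 :=
          (ENNReal.toReal_pos (Measure.measure_univ_ne_zero.mpr (Measure.toSphere_ne_zero _))
            (measure_ne_top _ _)).ne'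
        have : sphMoment N γ = (μ.toSphere Set.univ).toReal⁻¹ * ∫ ω, G ω ∂μ.toSphere := by
          rw [sphMoment, sphMeas, integral_smul_measure, ENNReal.toReal_inv, smul_eq_mul]
        rw [this]
        field_simp

lemma multinomial_spec_real {N l : ℕ} {β : Fin N → ℕ} (hβ : ∑ i, β i = l) :
    (∏ i, ((β i).factorial : ℝ)) * Nat.multinomial Finset.univ β = l.factorial := by
  rw [← hβ]
  exact_mod_cast Nat.multinomial_spec Finset.univ β

lemma prod_gaussE_X_pow {N l : ℕ} {β : Fin N → ℕ} (hβ : ∑ i, β i = l) :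
    ∏ i, gaussE (Polynomial.X ^ (2 * β i))
      = (2 ^ l * (l.factorial : ℝ))⁻¹ *
        (Nat.multinomial Finset.univ β * ∏ i, ((2 * β i).factorial : ℝ)) := by
  have h := multinomial_spec_real hβ
  have hpos : (∏ i, ((β i).factorial : ℝ)) ≠ 0 :=
    Finset.prod_ne_zero_iff.mpr fun i _ => by positivity
  have hpow : ∏ i, (2 : ℝ) ^ β i = 2 ^ l := by rw [Finset.prod_pow_eq_pow_sum, hβ]
  simp_rw [gaussE_X_pow_two_mul, Finset.prod_div_distrib, Finset.prod_mul_distrib]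
  rw [hpow, ← h]
  have : (Nat.multinomial Finset.univ β : ℝ) ≠ 0 := by
    exact_mod_cast (Nat.multinomial_pos _ _).ne'
  field_simp

/-- The Hermite inner product with `|v|^{2l}` is proportional to the spherical moment. -/
lemma exists_multinomial_mul_eq {N : ℕ} (hN : 0 < N) (l : ℕ) :
    ∃ K : ℝ, ∀ β : Fin N → ℕ, ∑ i, β i = l →
      Nat.multinomial Finset.univ β * ∏ i, ((2 * β i).factorial : ℝ) = K * sphMoment N β := by
  obtain ⟨R, hR⟩ := exists_prod_gaussE_eq_mul_sphMoment hN l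
  refine ⟨2 ^ l * l.factorial * R, fun β hβ => ?_⟩
  have h := (prod_gaussE_X_pow hβ).symm.trans (hR β hβ)
  have : (2 ^ l * (l.factorial : ℝ)) ≠ 0 := by positivity
  rw [mul_assoc, ← h, mul_inv_cancel_left₀ this]

lemma integral_hermProd_mul_Bproj {N l : ℕ} (hN : 0 < N) {β : Fin N → ℕ} (hβ : ∑ i, β i = l)
    (γ : Fin N → ℕ) (hγ : ∑ i, γ i = l) :
    Integrable (fun v => hermProd N β v * Bproj N (hermProd N γ) v * gam N v) ∧
    ∫ v, hermProd N β v * Bproj N (hermProd N γ) v * gam N v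
      = (Nat.multinomial Finset.univ β * ∏ i, ((2 * β i).factorial : ℝ)) * sphMoment N γ := by
  set T := Fintype.piFinset fun i => Finset.range (γ i + 1)
  set a : (Fin N → ℕ) → ℝ := fun δ => ∏ i, (hermiteReal (2 * γ i)).coeff (2 * δ i)
  have hB : ∀ v, Bproj N (hermProd N γ) v
      = ∑ δ ∈ T, a δ * sphMoment N δ * (∑ k, v k ^ 2) ^ (∑ i, δ i) := by
    intro v
    have hexp : ∀ ω : Metric.sphere (0 : EuclideanSpace ℝ (Fin N)) 1,
        hermProd N γ (fun i => Real.sqrt (∑ k, v k ^ 2) * (ω : EuclideanSpace ℝ (Fin N)) i)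
        = ∑ δ ∈ T, a δ * (∑ k, v k ^ 2) ^ (∑ i, δ i) *
          ∏ i, (ω : EuclideanSpace ℝ (Fin N)) i ^ (2 * δ i) := by
      intro ω
      simp_rw [hermProd, herm_even_expand]
      rw [Finset.prod_univ_sum]
      refine Finset.sum_congr rfl fun δ _ => ?_
      rw [← Finset.prod_pow_eq_pow_sum]
      simp only [a, ← Finset.prod_mul_distrib]
      refine Finset.prod_congr rfl fun i _ => ?_
      rw [mul_assoc, mul_pow, pow_mul (Real.sqrt _),
        Real.sq_sqrt (Finset.sum_nonneg fun k _ => sq_nonneg _)]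
    simp_rw [Bproj, hexp]
    rw [integral_finsetSum _ fun δ _ =>
      (integrable_sphMeas hN (continuous_sphere_monomial δ)).const_mul _]
    refine Finset.sum_congr rfl fun δ _ => ?_
    rw [integral_const_mul, sphMoment]; ring
  have hF : ∀ v, hermProd N β v * Bproj N (hermProd N γ) v * gam N v
      = ∑ δ ∈ T, a δ * sphMoment N δ *
        (hermProd N β v * (∑ k, v k ^ 2) ^ (∑ i, δ i) * gam N v) := by
    intro v
    rw [hB, Finset.mul_sum, Finset.sum_mul]
    exact Finset.sum_congr rfl fun δ _ => by ring
  simp_rw [hF]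
  refine ⟨integrable_finsetSum _ fun δ _ =>
    (integrable_hermProd_mul_sum_sq_pow β _).const_mul _, ?_⟩
  rw [integral_finsetSum _ fun δ _ => (integrable_hermProd_mul_sum_sq_pow β _).const_mul _]
  simp_rw [integral_const_mul]
  have hle : ∀ δ ∈ T, ∀ i, δ i ≤ γ i := fun δ hδ i =>
    Nat.lt_succ_iff.mp (Finset.mem_range.mp (Fintype.mem_piFinset.mp hδ i))
  rw [Finset.sum_eq_single γ]
  · rw [integral_hermProd_mul_sum_sq_pow β (by omega), if_pos (by omega)]
    simp [a, coeff_hermiteReal_self]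
    ring
  · intro δ hδ hne
    have h1 : ∑ i, δ i ≤ ∑ i, γ i := Finset.sum_le_sum fun i _ => hle δ hδ i
    rw [integral_hermProd_mul_sum_sq_pow β (by omega), if_neg, mul_zero]
    intro h
    rw [hβ] at h
    refine hne (funext fun i => ?_)
    exact (Finset.sum_eq_sum_iff_of_le fun i _ => hle δ hδ i).mp (h.symm.trans hγ.symm) i
      (Finset.mem_univ i)
  · intro h
    exact absurd (Fintype.mem_piFinset.mpr fun i => by simp) h

lemma mul_sum_sq_le {ι : Type*} (S : Finset ι) (c W Γ m : ι → ℝ) {K : ℝ} (hK : 0 ≤ K)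
    (hW : ∀ i ∈ S, 0 < W i) (hm : ∀ i ∈ S, m i * W i = K * Γ i) :
    K * (∑ i ∈ S, c i * Γ i) ^ 2 ≤ (∑ i ∈ S, m i * Γ i) * ∑ i ∈ S, c i ^ 2 * W i := by
  have h := Finset.sum_sq_le_sum_mul_sum_of_sq_le_mul S (r := fun i => c i * Γ i)
    (f := fun i => Γ i ^ 2 / W i) (g := fun i => c i ^ 2 * W i)
    (fun i hi => div_nonneg (sq_nonneg _) (hW i hi).le)
    (fun i hi => mul_nonneg (sq_nonneg _) (hW i hi).le)
    (fun i hi => by have := (hW i hi).ne'; exact le_of_eq (by field_simp))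
  have e : ∑ i ∈ S, m i * Γ i = K * ∑ i ∈ S, Γ i ^ 2 / W i := by
    rw [Finset.mul_sum]
    refine Finset.sum_congr rfl fun i hi => ?_
    have := (hW i hi).ne'
    field_simp
    linear_combination Γ i * hm i hi
  rw [e, mul_assoc]
  exact mul_le_mul_of_nonneg_left h hK

/-- If `x` is the smaller root of the characteristic polynomial of `μ(I - sP) + L(I - B)` on a
plane, where the projection `P` and the rank-one projection `B` make an angle with squared cosine
`C`, then `x` bounds the quadratic form of this operator from below. -/
lemma smaller_root_bound {mu L s C x p q X Y : ℝ} (hL : 0 ≤ L)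
    (hp : 0 ≤ p) (hq : 0 ≤ q) (hX : X ^ 2 ≤ C * p) (hY : Y ^ 2 ≤ (1 - C) * q)
    (hC0 : 0 ≤ C) (hC1 : C ≤ 1)
    (hroot : x ^ 2 - (L + (2 - s) * mu) * x + ((1 - s) * mu ^ 2 + L * mu - L * mu * s * C) = 0)
    (hsmall : ∀ y : ℝ,
      y ^ 2 - (L + (2 - s) * mu) * y + ((1 - s) * mu ^ 2 + L * mu - L * mu * s * C) = 0 → x ≤ y) :
    x * (p + q) ≤ mu * (1 - s) * p + mu * q + L * (p + q) - L * (X + Y) ^ 2 := by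
  have hx := hsmall (L + (2 - s) * mu - x) (by linear_combination hroot)
  have hsum : 0 ≤ (mu * (1 - s) + L * (1 - C) - x) + (mu + L * C - x) := by linarith
  have hprod : (mu * (1 - s) + L * (1 - C) - x) * (mu + L * C - x) = L ^ 2 * (C * (1 - C)) := by
    linear_combination hroot
  have hprod0 : 0 ≤ L ^ 2 * (C * (1 - C)) :=
    mul_nonneg (sq_nonneg _) (mul_nonneg hC0 (by linarith))
  generalize hA : mu * (1 - s) + L * (1 - C) - x = A at *
  generalize hB : mu + L * C - x = B at *
  have hA0 : 0 ≤ A := by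
    by_contra! h
    nlinarith
  have hB0 : 0 ≤ B := by
    by_contra! h
    nlinarith
  have hcross : 2 * (L * (X * Y)) ≤ A * p + B * q := by
    refine le_of_sq_le_sq ?_ (by positivity)
    have h1 : X ^ 2 * Y ^ 2 ≤ (C * p) * ((1 - C) * q) :=
      mul_le_mul hX hY (sq_nonneg _) (by positivity)
    have h2 : L ^ 2 * (X ^ 2 * Y ^ 2) ≤ L ^ 2 * ((C * p) * ((1 - C) * q)) :=
      mul_le_mul_of_nonneg_left h1 (sq_nonneg _)
    have h3 : L ^ 2 * ((C * p) * ((1 - C) * q)) = (A * p) * (B * q) := by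
      linear_combination (-(p * q)) * hprod
    nlinarith [sq_nonneg (A * p - B * q)]
  have h4 := mul_le_mul_of_nonneg_left hX hL
  have h5 := mul_le_mul_of_nonneg_left hY hL
  rw [← hA, ← hB] at hcross
  nlinarith

lemma weighted_sum_bound {ι : Type*} (S : Finset ι) (A : ι → Prop) [DecidablePred A]
    (c W Γ m τ : ι → ℝ) {K s mu L x C : ℝ}
    (hW : ∀ i ∈ S, 0 < W i) (hm : ∀ i ∈ S, m i * W i = K * Γ i)
    (hK : 0 < K) (h1 : ∑ i ∈ S, m i * Γ i = 1) (hC : ∑ i ∈ S with A i, m i * Γ i = C)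
    (hτA : ∀ i ∈ S, A i → τ i = 1 - s) (hτ : ∀ i ∈ S, ¬ A i → 1 ≤ τ i)
    (hmu : 0 ≤ mu) (hL : 0 ≤ L)
    (hroot : x ^ 2 - (L + (2 - s) * mu) * x + ((1 - s) * mu ^ 2 + L * mu - L * mu * s * C) = 0)
    (hsmall : ∀ y : ℝ,
      y ^ 2 - (L + (2 - s) * mu) * y + ((1 - s) * mu ^ 2 + L * mu - L * mu * s * C) = 0 → x ≤ y) :
    x * ∑ i ∈ S, c i ^ 2 * W i
      ≤ ∑ i ∈ S, (mu * τ i + L) * (c i ^ 2 * W i) - L * (K * (∑ i ∈ S, c i * Γ i) ^ 2) := by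
  have split : ∀ f : ι → ℝ, ∑ i ∈ S, f i = ∑ i ∈ S with A i, f i + ∑ i ∈ S with ¬ A i, f i :=
    fun f => (Finset.sum_filter_add_sum_filter_not S A f).symm
  have hmem : ∀ (B : ι → Prop) [DecidablePred B], ∀ i ∈ S.filter B, i ∈ S :=
    fun B _ i hi => (Finset.mem_filter.mp hi).1
  have hΓ : ∀ i ∈ S, 0 ≤ m i * Γ i := fun i hi => by
    have : K * (m i * Γ i) = m i ^ 2 * W i := by linear_combination (-m i) * hm i hi
    exact nonneg_of_mul_nonneg_right (this ▸ mul_nonneg (sq_nonneg _) (hW i hi).le) hK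
  have hC' : ∑ i ∈ S with ¬ A i, m i * Γ i = 1 - C := by
    rw [← h1, split, hC]; ring
  have hC0 : 0 ≤ C := hC ▸ Finset.sum_nonneg fun i hi => hΓ i (hmem A i hi)
  have hC1 : 0 ≤ 1 - C := hC' ▸ Finset.sum_nonneg fun i hi => hΓ i (hmem _ i hi)
  have hnn : ∀ (B : ι → Prop) [DecidablePred B], 0 ≤ ∑ i ∈ S with B i, c i ^ 2 * W i :=
    fun B _ => Finset.sum_nonneg fun i hi => mul_nonneg (sq_nonneg _) (hW i (hmem B i hi)).le
  have bX := mul_sum_sq_le (S.filter A) c W Γ m hK.le (fun i hi => hW i (hmem _ i hi))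
    fun i hi => hm i (hmem _ i hi)
  have bY := mul_sum_sq_le (S.filter fun i => ¬ A i) c W Γ m hK.le
    (fun i hi => hW i (hmem _ i hi)) fun i hi => hm i (hmem _ i hi)
  rw [hC] at bX
  rw [hC'] at bY
  have hsqK := Real.sq_sqrt hK.le
  have key := smaller_root_bound hL (hnn A) (hnn fun i => ¬ A i)
    (X := Real.sqrt K * ∑ i ∈ S with A i, c i * Γ i)
    (Y := Real.sqrt K * ∑ i ∈ S with ¬ A i, c i * Γ i)
    (by rwa [mul_pow, hsqK]) (by rwa [mul_pow, hsqK]) hC0 (by linarith) hroot hsmall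
  rw [← mul_add, mul_pow, hsqK, ← split, ← split] at key
  refine key.trans (sub_le_sub_right ?_ _)
  have eA : ∑ i ∈ S with A i, (mu * τ i + L) * (c i ^ 2 * W i)
      = (mu * (1 - s) + L) * ∑ i ∈ S with A i, c i ^ 2 * W i := by
    rw [Finset.mul_sum]
    refine Finset.sum_congr rfl fun i hi => ?_
    rw [hτA i (hmem _ i hi) (Finset.mem_filter.mp hi).2]
  have eB : (mu + L) * ∑ i ∈ S with ¬ A i, c i ^ 2 * W i
      ≤ ∑ i ∈ S with ¬ A i, (mu * τ i + L) * (c i ^ 2 * W i) := by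
    rw [Finset.mul_sum]
    refine Finset.sum_le_sum fun i hi => mul_le_mul_of_nonneg_right ?_
      (mul_nonneg (sq_nonneg _) (hW i (hmem _ i hi)).le)
    have := mul_le_mul_of_nonneg_left (hτ i (hmem _ i hi) (Finset.mem_filter.mp hi).2) hmu
    linarith
  rw [split fun i => (mu * τ i + L) * (c i ^ 2 * W i), split fun i => c i ^ 2 * W i, eA]
  linarith

lemma continuous_hermProd {N : ℕ} (β : Fin N → ℕ) : Continuous (hermProd N β) := by
  have : hermProd N β = fun v => ∏ i, (hermiteReal (2 * β i)).eval (v i) :=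
    funext fun v => hermProd_eq_eval β v
  rw [this]; fun_prop

lemma Bproj_sum_hermProd {N : ℕ} (hN : 0 < N) (S : Finset (Fin N → ℕ)) (c : (Fin N → ℕ) → ℝ)
    (v : Fin N → ℝ) :
    Bproj N (fun v => ∑ β ∈ S, c β * hermProd N β v) v
      = ∑ β ∈ S, c β * Bproj N (hermProd N β) v := by
  have hint : ∀ β ∈ S, Integrable (fun ω : Metric.sphere (0 : EuclideanSpace ℝ (Fin N)) 1 =>
      c β * hermProd N β fun i => Real.sqrt (∑ k, v k ^ 2) * (ω : EuclideanSpace ℝ (Fin N)) i)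
      (sphMeas N) := fun β _ => (integrable_sphMeas hN
    ((continuous_hermProd β).comp (by fun_prop))).const_mul _
  simp only [Bproj]
  rw [integral_finsetSum _ hint]
  simp_rw [integral_const_mul]

lemma integral_sum_hermProd_mul_hermProd {N : ℕ} (S : Finset (Fin N → ℕ))
    (a b : (Fin N → ℕ) → ℝ) :
    Integrable (fun v => (∑ β ∈ S, a β * hermProd N β v) * (∑ γ ∈ S, b γ * hermProd N γ v)
      * gam N v) ∧
    ∫ v, (∑ β ∈ S, a β * hermProd N β v) * (∑ γ ∈ S, b γ * hermProd N γ v) * gam N v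
      = ∑ β ∈ S, a β * b β * ∏ i, ((2 * β i).factorial : ℝ) := by
  have e : ∀ v, (∑ β ∈ S, a β * hermProd N β v) * (∑ γ ∈ S, b γ * hermProd N γ v) * gam N v
      = ∑ β ∈ S, ∑ γ ∈ S, a β * b γ * (hermProd N β v * hermProd N γ v * gam N v) := by
    intro v
    rw [Finset.sum_mul_sum, Finset.sum_mul]
    refine Finset.sum_congr rfl fun β _ => ?_
    rw [Finset.sum_mul]
    exact Finset.sum_congr rfl fun γ _ => by ring
  have hint : ∀ β ∈ S, ∀ γ ∈ S, Integrable (fun v => a β * b γ *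
      (hermProd N β v * hermProd N γ v * gam N v)) :=
    fun β _ γ _ => (integrable_hermProd_mul_hermProd β γ).const_mul _
  simp_rw [e]
  refine ⟨integrable_finsetSum _ fun β hβ => integrable_finsetSum _ (hint β hβ), ?_⟩
  rw [integral_finsetSum _ fun β hβ => integrable_finsetSum _ (hint β hβ)]
  refine Finset.sum_congr rfl fun β hβ => ?_
  rw [integral_finsetSum _ (hint β hβ)]
  simp_rw [integral_const_mul, integral_hermProd_mul_hermProd]
  rw [Finset.sum_eq_single β]
  · rw [if_pos rfl]
  · intro γ _ h
    rw [if_neg h.symm, mul_zero]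
  · intro h
    exact absurd hβ h

lemma integral_sum_hermProd_mul_Bproj {N l : ℕ} (hN : 0 < N) (c : (Fin N → ℕ) → ℝ) :
    Integrable (fun v => (∑ β ∈ Finset.Nat.antidiagonalTuple N l, c β * hermProd N β v)
      * (∑ γ ∈ Finset.Nat.antidiagonalTuple N l, c γ * Bproj N (hermProd N γ) v) * gam N v) ∧
    ∫ v, (∑ β ∈ Finset.Nat.antidiagonalTuple N l, c β * hermProd N β v)
      * (∑ γ ∈ Finset.Nat.antidiagonalTuple N l, c γ * Bproj N (hermProd N γ) v) * gam N v
      = (∑ β ∈ Finset.Nat.antidiagonalTuple N l,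
          c β * (Nat.multinomial Finset.univ β * ∏ i, ((2 * β i).factorial : ℝ)))
        * ∑ γ ∈ Finset.Nat.antidiagonalTuple N l, c γ * sphMoment N γ := by
  set S := Finset.Nat.antidiagonalTuple N l
  have hS : ∀ β ∈ S, ∑ i, β i = l := fun β hβ => Finset.Nat.mem_antidiagonalTuple.mp hβ
  have e : ∀ v, (∑ β ∈ S, c β * hermProd N β v) * (∑ γ ∈ S, c γ * Bproj N (hermProd N γ) v)
      * gam N v
      = ∑ β ∈ S, ∑ γ ∈ S, c β * c γ * (hermProd N β v * Bproj N (hermProd N γ) v * gam N v) := by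
    intro v
    rw [Finset.sum_mul_sum, Finset.sum_mul]
    refine Finset.sum_congr rfl fun β _ => ?_
    rw [Finset.sum_mul]
    exact Finset.sum_congr rfl fun γ _ => by ring
  have hint : ∀ β ∈ S, ∀ γ ∈ S, Integrable (fun v => c β * c γ *
      (hermProd N β v * Bproj N (hermProd N γ) v * gam N v)) :=
    fun β hβ γ hγ => (integral_hermProd_mul_Bproj hN (hS β hβ) γ (hS γ hγ)).1.const_mul _
  simp_rw [e]
  refine ⟨integrable_finsetSum _ fun β hβ => integrable_finsetSum _ (hint β hβ), ?_⟩
  rw [integral_finsetSum _ fun β hβ => integrable_finsetSum _ (hint β hβ), Finset.sum_mul_sum]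
  refine Finset.sum_congr rfl fun β hβ => ?_
  rw [integral_finsetSum _ (hint β hβ)]
  refine Finset.sum_congr rfl fun γ hγ => ?_
  rw [integral_const_mul, (integral_hermProd_mul_Bproj hN (hS β hβ) γ (hS γ hγ)).2]
  ring

lemma multinomial_single {N : ℕ} (j : Fin N) (l : ℕ) :
    Nat.multinomial Finset.univ (Pi.single j l : Fin N → ℕ) = 1 := by
  have h := Nat.multinomial_spec Finset.univ (Pi.single j l : Fin N → ℕ)
  rw [Finset.sum_pi_single' j l, if_pos (Finset.mem_univ j),
    Finset.prod_eq_single j (fun i _ hi => by simp [hi]) (by simp), Pi.single_eq_same] at h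
  exact Nat.eq_of_mul_eq_mul_left (Nat.factorial_pos l) (by rw [h, mul_one])

lemma sphMoment_single {N : ℕ} (j : Fin N) (l : ℕ) :
    sphMoment N (Pi.single j l) = ∫ ω : Metric.sphere (0 : EuclideanSpace ℝ (Fin N)) 1,
      (ω : EuclideanSpace ℝ (Fin N)) j ^ (2 * l) ∂(sphMeas N) := by
  refine integral_congr_ae (.of_forall fun ω => ?_)
  show ∏ i, _ = _
  rw [Finset.prod_eq_single j (fun i _ hi => by simp [hi]) (by simp), Pi.single_eq_same]

lemma sum_single_multinomial_mul_sphMoment {N l : ℕ} (hl : 1 ≤ l) (j₀ : Fin N)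
    [DecidablePred fun β : Fin N → ℕ => ∃ j, β = Pi.single j l] {K : ℝ} (hK : K ≠ 0)
    (hm : ∀ β : Fin N → ℕ, ∑ i, β i = l →
      Nat.multinomial Finset.univ β * ∏ i, ((2 * β i).factorial : ℝ) = K * sphMoment N β) :
    ∑ β ∈ Finset.Nat.antidiagonalTuple N l with ∃ j, β = Pi.single j l,
        (Nat.multinomial Finset.univ β : ℝ) * sphMoment N β
      = N * ∫ ω : Metric.sphere (0 : EuclideanSpace ℝ (Fin N)) 1,
          (ω : EuclideanSpace ℝ (Fin N)) j₀ ^ (2 * l) ∂(sphMeas N) := by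
  have hsum : ∀ j : Fin N, ∑ i, (Pi.single j l : Fin N → ℕ) i = l := fun j => by simp
  have hS : (Finset.Nat.antidiagonalTuple N l).filter (fun β => ∃ j, β = Pi.single j l)
      = Finset.univ.image fun j : Fin N => (Pi.single j l : Fin N → ℕ) := by
    ext β
    simp only [Finset.mem_filter, Finset.Nat.mem_antidiagonalTuple, Finset.mem_image,
      Finset.mem_univ, true_and]
    constructor
    · rintro ⟨-, j, rfl⟩
      exact ⟨j, rfl⟩
    · rintro ⟨j, rfl⟩
      exact ⟨hsum j, j, rfl⟩
  have hinj : Function.Injective fun j : Fin N => (Pi.single j l : Fin N → ℕ) := by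
    intro i j h
    by_contra hne
    have := congr_fun h i
    simp [Pi.single_eq_of_ne hne] at this
    omega
  have hconst : ∀ j, sphMoment N (Pi.single j l) = sphMoment N (Pi.single j₀ l) := by
    intro j
    have hv : ∀ j : Fin N, ((2 * l).factorial : ℝ) = K * sphMoment N (Pi.single j l) := by
      intro j
      rw [← hm _ (hsum j), multinomial_single,
        Finset.prod_eq_single j (fun i _ hi => by simp [hi]) (by simp)]
      simp
    exact mul_left_cancel₀ hK ((hv j).symm.trans (hv j₀))
  rw [hS, Finset.sum_image hinj.injOn]
  simp [multinomial_single, hconst, ← sphMoment_single]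

/-- on L_{2l}, the operator μ𝓛_T + λΛ_N(I−B) is bounded below by the
smaller root x_l of the quadratic
x² − (λΛ_N + (2−s_{2l})μ)x + (1−s_{2l})μ² + λΛ_N μ − λΛ_N μ s_{2l} N Γ_l = 0. -/
theorem lower_bound_on_L2l (N : ℕ) (hN : 2 ≤ N) (lam mu : ℝ)
    (hlam : 0 < lam) (hmu : 0 < mu) (l : ℕ) (hl : 1 ≤ l) (x : ℝ)
    (hroot :
      x ^ 2 - (lam * (((N : ℝ) + 2) / (2 * ((N : ℝ) - 1))) + (2 - sCoef (2 * l)) * mu) * x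
        + ((1 - sCoef (2 * l)) * mu ^ 2 + lam * (((N : ℝ) + 2) / (2 * ((N : ℝ) - 1))) * mu
          - lam * (((N : ℝ) + 2) / (2 * ((N : ℝ) - 1))) * mu * sCoef (2 * l) * (N : ℝ)
            * (∫ ω : Metric.sphere (0 : EuclideanSpace ℝ (Fin N)) 1,
                ((ω : EuclideanSpace ℝ (Fin N)) (⟨0, by omega⟩ : Fin N)) ^ (2 * l)
                ∂(sphMeas N))) = 0)
    (hsmall : ∀ y : ℝ,
      y ^ 2 - (lam * (((N : ℝ) + 2) / (2 * ((N : ℝ) - 1))) + (2 - sCoef (2 * l)) * mu) * y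
        + ((1 - sCoef (2 * l)) * mu ^ 2 + lam * (((N : ℝ) + 2) / (2 * ((N : ℝ) - 1))) * mu
          - lam * (((N : ℝ) + 2) / (2 * ((N : ℝ) - 1))) * mu * sCoef (2 * l) * (N : ℝ)
            * (∫ ω : Metric.sphere (0 : EuclideanSpace ℝ (Fin N)) 1,
                ((ω : EuclideanSpace ℝ (Fin N)) (⟨0, by omega⟩ : Fin N)) ^ (2 * l)
                ∂(sphMeas N))) = 0 → x ≤ y)
    (h : (Fin N → ℝ) → ℝ)
    (hmemL : ∃ c : (Fin N → ℕ) → ℝ, ∀ v,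
      h v = ∑ β ∈ Finset.Nat.antidiagonalTuple N l, c β * ∏ i, Herm (2 * β i) (v i)) :
    x * iprod N h h ≤
      iprod N h (fun v => mu * LTherm N h v
        + lam * (((N : ℝ) + 2) / (2 * ((N : ℝ) - 1))) * (h v - Bproj N h v)) := by
  classical
  have hN0 : 0 < N := by omega
  obtain ⟨c, hc⟩ := hmemL
  obtain rfl : h = fun v => ∑ β ∈ Finset.Nat.antidiagonalTuple N l, c β * hermProd N β v :=
    funext hc
  obtain ⟨K, hK⟩ := exists_multinomial_mul_eq hN0 l
  set L := lam * (((N : ℝ) + 2) / (2 * ((N : ℝ) - 1))) with hLdef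
  set s := sCoef (2 * l)
  set S := Finset.Nat.antidiagonalTuple N l
  set W : (Fin N → ℕ) → ℝ := fun β => ∏ i, ((2 * β i).factorial : ℝ)
  set m : (Fin N → ℕ) → ℝ := fun β => Nat.multinomial Finset.univ β
  set A : (Fin N → ℕ) → Prop := fun β => ∃ j, β = Pi.single j l
  have hS : ∀ β ∈ S, ∑ i, β i = l := fun β hβ => Finset.Nat.mem_antidiagonalTuple.mp hβ
  have hW : ∀ β, 0 < W β := fun β => Finset.prod_pos fun i _ => by positivity
  have hL : 0 ≤ L := by
    have : (2 : ℝ) ≤ N := by exact_mod_cast hN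
    have : 0 < (N : ℝ) - 1 := by linarith
    positivity
  have hmΓ := sum_multinomial_mul_sphMoment hN0 l
  have hKpos : 0 < K := by
    have h0 : K = ∑ β ∈ S, m β * (m β * W β) := by
      rw [← mul_one K, ← hmΓ, Finset.mul_sum]
      refine Finset.sum_congr rfl fun β hβ => ?_
      rw [hK β (hS β hβ)]
      ring
    have hm : ∀ β, 0 < m β := fun β => Nat.cast_pos.mpr (Nat.multinomial_pos _ _)
    rw [h0]
    refine Finset.sum_pos (fun β _ => mul_pos (hm β) (mul_pos (hm β) (hW β)))
      ⟨Pi.single ⟨0, hN0⟩ l, ?_⟩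
    simp [S, Finset.Nat.mem_antidiagonalTuple]
  have key := weighted_sum_bound S A c W (sphMoment N) m thermEig (fun β _ => hW β)
    (fun β hβ => hK β (hS β hβ)) hKpos hmΓ
    (sum_single_multinomial_mul_sphMoment hl ⟨0, hN0⟩ hKpos.ne' hK)
    (fun β _ ⟨j, hj⟩ => hj ▸ thermEig_single j l)
    (fun β hβ hA => one_le_thermEig hN0 (hS β hβ) (not_exists.mp hA)) hmu.le hL
    (by simpa only [mul_assoc] using hroot) (by simpa only [mul_assoc] using hsmall)
  have hnorm := (integral_sum_hermProd_mul_hermProd S c c).2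
  have hT := integral_sum_hermProd_mul_hermProd S c fun β => (mu * thermEig β + L) * c β
  have hB := integral_sum_hermProd_mul_Bproj (l := l) hN0 c
  have hop : ∀ v, (∑ β ∈ S, c β * hermProd N β v) *
      (mu * LTherm N (fun v => ∑ β ∈ S, c β * hermProd N β v) v
        + L * ((∑ β ∈ S, c β * hermProd N β v)
          - Bproj N (fun v => ∑ β ∈ S, c β * hermProd N β v) v)) * gam N v
      = (∑ β ∈ S, c β * hermProd N β v) *
          (∑ β ∈ S, (mu * thermEig β + L) * c β * hermProd N β v) * gam N v
        - L * ((∑ β ∈ S, c β * hermProd N β v) *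
          (∑ β ∈ S, c β * Bproj N (hermProd N β) v) * gam N v) := by
    intro v
    have e : ∑ β ∈ S, (mu * thermEig β + L) * c β * hermProd N β v
        = mu * ∑ β ∈ S, c β * thermEig β * hermProd N β v + L * ∑ β ∈ S, c β * hermProd N β v := by
      rw [Finset.mul_sum, Finset.mul_sum, ← Finset.sum_add_distrib]
      exact Finset.sum_congr rfl fun β _ => by ring
    rw [LTherm_sum_hermProd, Bproj_sum_hermProd hN0, e]
    ring
  have hmW : ∑ β ∈ S, c β * (m β * W β) = K * ∑ β ∈ S, c β * sphMoment N β := by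
    rw [Finset.mul_sum]
    refine Finset.sum_congr rfl fun β hβ => ?_
    rw [hK β (hS β hβ)]
    ring
  simp only [iprod]
  simp_rw [hop]
  rw [integral_sub hT.1 (hB.1.const_mul L), integral_const_mul, hnorm, hT.2, hB.2, hmW]
  convert key using 2
  · exact Finset.sum_congr rfl fun β _ => by ring
  · exact Finset.sum_congr rfl fun β _ => by ring
  · ring

end
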